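/- arXiv:2405.08561 — 2 statements merged into one kernel-verified Lean document; each statement's English description precedes it below -/
import Mathlib

section
/- Let K be a monotone kernel function, n ∈ ℕ, r₁,…,rₙ > 0 with R := r₁ + … + rₙ, and let J be an n-field function on ℝ that is R-admissible for K. If e ∈ S^∞ is an equioscillation point on ℝ, then e is both a minimax point and a maximin point: M(S^∞) = m̄(e) = m̲(e) = m(S^∞). -/
open Filter Set Topology

noncomputable section

/-- A kernel function: finite on `ℝ \ {0}`, concave on `(-∞,0)` and `(0,∞)`,
with equal one-sided limits at `0`, equal to `K 0` (real or `⊥`). -/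
def IsKernel (K : ℝ → EReal) : Prop :=
  (∀ t : ℝ, t ≠ 0 → K t ≠ ⊥ ∧ K t ≠ ⊤) ∧
  ConcaveOn ℝ (Iio (0:ℝ)) (fun t => (K t).toReal) ∧
  ConcaveOn ℝ (Ioi (0:ℝ)) (fun t => (K t).toReal) ∧
  K 0 ≠ ⊤ ∧
  Tendsto K (𝓝[<] (0:ℝ)) (𝓝 (K 0)) ∧
  Tendsto K (𝓝[>] (0:ℝ)) (𝓝 (K 0))

/-- A monotone kernel: nonincreasing on `(-∞,0)`, nondecreasing on `(0,∞)`. -/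
def MonotoneKernel (K : ℝ → EReal) : Prop :=
  IsKernel K ∧ AntitoneOn K (Iio (0:ℝ)) ∧ MonotoneOn K (Ioi (0:ℝ))

/-- An `n`-field function on `ℝ`: bounded above, finite at more than `n` points. -/
def IsFieldFn (n : ℕ) (J : ℝ → EReal) : Prop :=
  (∃ c : ℝ, ∀ t, J t ≤ (c : EReal)) ∧
  (∃ S : Finset ℝ, n < S.card ∧ ∀ x ∈ S, J x ≠ ⊥)

/-- `J` is `R`-admissible for `K`: `J(t) + R·K(t) → -∞` as `|t| → ∞`. -/
def IsAdmissible (K J : ℝ → EReal) (R : ℝ) : Prop :=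
  Tendsto (fun t => J t + (R : EReal) * K t) (cocompact ℝ) (𝓝 ⊥)

/-- The sum of translates function `F(y,t) = J(t) + ∑ rⱼ K(t - yⱼ)`. -/
def SumTrans (K J : ℝ → EReal) {n : ℕ} (r y : Fin n → ℝ) (t : ℝ) : EReal :=
  J t + ∑ j, (r j : EReal) * K (t - y j)

/-- For monotone `y`, `cell y j` is `[y_j, y_{j+1}]` (with `y_0 = -∞`, `y_{n+1} = ∞`). -/
def cell {n : ℕ} (y : Fin n → ℝ) (j : Fin (n+1)) : Set ℝ :=
  {t | (∀ i : Fin n, (i : ℕ) < (j : ℕ) → y i ≤ t) ∧ (∀ i : Fin n, (j : ℕ) ≤ (i : ℕ) → t ≤ y i)}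

/-- The local maximum `mⱼ(y)` over the `j`-th cell. -/
def mloc (K J : ℝ → EReal) {n : ℕ} (r y : Fin n → ℝ) (j : Fin (n+1)) : EReal :=
  sSup (SumTrans K J r y '' cell y j)

/-- The local maximum `mⱼ^b(y)` over the `j`-th cell intersected with `[-b,b]`. -/
def mlocSeg (K J : ℝ → EReal) {n : ℕ} (r y : Fin n → ℝ) (b : ℝ) (j : Fin (n+1)) : EReal :=
  sSup (SumTrans K J r y '' (cell y j ∩ Icc (-b) b))

/-- `q` has the Mhaskar–Rakhmanov–Saff property for `(K, J, R)` (with `n` nodes). -/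
def HasMRS (K J : ℝ → EReal) (R : ℝ) (n : ℕ) (q : ℝ) : Prop :=
  ∀ r : Fin n → ℝ, (∀ j, 0 < r j) → (∑ j, r j) ≤ R →
    ∀ y : Fin n → ℝ, Monotone y →
      sSup (range (SumTrans K J r y)) = sSup (SumTrans K J r y '' Icc (-q) q)

theorem ConcaveOn.exists_tangent_Ioi {g : ℝ → ℝ} (hg : ConcaveOn ℝ (Ioi (0 : ℝ)) g)
    {q : ℝ} (hq : 0 < q) : ∃ s : ℝ, ∀ p, 0 < p → g p ≤ g q + s * (p - q) := by
  obtain ⟨s, hs₁, hs₂⟩ := exists_between_of_forall_le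
    (s := (fun z => (g z - g q) / (z - q)) '' Ioi q)
    (t := (fun p => (g q - g p) / (q - p)) '' Ioo 0 q)
    (nonempty_Ioi.image _) ((nonempty_Ioo.2 hq).image _) (by
      rintro _ ⟨z, hz, rfl⟩ _ ⟨p, hp, rfl⟩
      exact hg.slope_anti_adjacent (mem_Ioi.2 hp.1) (mem_Ioi.2 (hq.trans hz)) hp.2 hz)
  refine ⟨s, fun p hp => ?_⟩
  rcases lt_trichotomy p q with h | rfl | h
  · have := hs₂ (mem_image_of_mem _ (⟨hp, h⟩ : p ∈ Ioo 0 q))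
    rw [le_div_iff₀ (sub_pos.2 h)] at this
    linarith
  · simp
  · have := hs₁ (mem_image_of_mem _ (h : p ∈ Ioi q))
    rw [div_le_iff₀ (sub_pos.2 h)] at this
    linarith

/-- The restriction of a monotone kernel to one of the half-lines, read as a function of the
distance to `0`. -/
structure IsHalfKernel (H : ℝ → EReal) : Prop where
  finite : ∀ p, 0 < p → H p ≠ ⊥ ∧ H p ≠ ⊤
  concave : ConcaveOn ℝ (Ioi (0 : ℝ)) fun p => (H p).toReal
  mono : MonotoneOn H (Ioi (0 : ℝ))
  tendsto_zero : Tendsto H (𝓝[>] (0 : ℝ)) (𝓝 (H 0))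

theorem MonotoneKernel.isHalfKernel {K : ℝ → EReal} (hK : MonotoneKernel K) :
    IsHalfKernel K :=
  ⟨fun p hp => hK.1.1 p hp.ne', hK.1.2.2.1, hK.2.2, hK.1.2.2.2.2.2⟩

theorem MonotoneKernel.comp_neg {K : ℝ → EReal} (hK : MonotoneKernel K) :
    MonotoneKernel fun t => K (-t) := by
  obtain ⟨⟨hfin, hneg, hpos, h0, hl, hr⟩, hanti, hmono⟩ := hK
  refine ⟨⟨fun t ht => hfin _ (neg_ne_zero.2 ht), ?_, ?_, by simpa using h0, ?_, ?_⟩, ?_, ?_⟩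
  · simpa [Function.comp_def, preimage, Iio, Ioi] using hpos.comp_linearMap (-LinearMap.id : ℝ →ₗ[ℝ] ℝ)
  · simpa [Function.comp_def, preimage, Iio, Ioi] using hneg.comp_linearMap (-LinearMap.id : ℝ →ₗ[ℝ] ℝ)
  · simpa [Function.comp_def] using hr.comp (by simpa using tendsto_neg_nhdsLT (a := (0 : ℝ)))
  · simpa [Function.comp_def] using hl.comp (by simpa using tendsto_neg_nhdsGT (a := (0 : ℝ)))
  · exact fun a ha b hb hab => hmono (by simpa using hb) (by simpa using ha) (neg_le_neg hab)
  · exact fun a ha b hb hab => hanti (by simpa using hb) (by simpa using ha) (neg_le_neg hab)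

theorem IsHalfKernel.exists_tangent {H : ℝ → EReal} (hH : IsHalfKernel H) {q : ℝ} (hq : 0 < q) :
    ∃ s : ℝ, ∀ p, 0 ≤ p → H p ≤ (((H q).toReal + s * (p - q) : ℝ) : EReal) := by
  obtain ⟨s, hs⟩ := hH.concave.exists_tangent_Ioi hq
  have key : ∀ p, 0 < p → H p ≤ (((H q).toReal + s * (p - q) : ℝ) : EReal) := fun p hp => by
    rw [← EReal.coe_toReal (hH.finite p hp).2 (hH.finite p hp).1]
    exact_mod_cast hs p hp
  refine ⟨s, fun p hp => ?_⟩
  rcases hp.eq_or_lt with rfl | hp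
  · refine le_of_tendsto_of_tendsto hH.tendsto_zero
      (Tendsto.mono_left (Continuous.tendsto ?_ 0) nhdsWithin_le_nhds)
      (eventually_mem_nhdsWithin.mono key)
    exact continuous_coe_real_ereal.comp (by fun_prop)
  · exact key p hp

/-- A weak majorization inequality for half-kernels: if the weighted partial sums of `q - p` are
nonnegative and `q` is increasing, then passing from `p` to `q` increases the weighted sum. -/
theorem IsHalfKernel.sum_le_sum {H : ℝ → EReal} (hH : IsHalfKernel H) {m : ℕ} {r p q : ℕ → ℝ}
    (hr : ∀ i < m, 0 < r i) (hp : ∀ i < m, 0 ≤ p i) (hq : ∀ i < m, 0 ≤ q i)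
    (hmono : ∀ i j, i ≤ j → j < m → q i ≤ q j)
    (hW : ∀ l ≤ m, 0 ≤ ∑ i ∈ Finset.range l, r i * (q i - p i)) :
    ∑ i ∈ Finset.range m, (r i : EReal) * H (p i) ≤
      ∑ i ∈ Finset.range m, (r i : EReal) * H (q i) := by
  choose! s hs using fun q (hq : 0 < q) => hH.exists_tangent hq
  have hs' : ∀ q p, 0 < q → 0 < p → (H p).toReal ≤ (H q).toReal + s q * (p - q) := by
    intro q p hq hp
    have := hs q hq p hp.le
    rw [← EReal.coe_toReal (hH.finite p hp).2 (hH.finite p hp).1] at this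
    exact_mod_cast this
  have hs0 : ∀ q, 0 < q → 0 ≤ s q := by
    intro q hq
    have h1 := hs' q (q + 1) hq (by linarith)
    have h2 := EReal.toReal_le_toReal (hH.mono (mem_Ioi.2 hq)
      (mem_Ioi.2 (by linarith : 0 < q + 1)) (by linarith)) (hH.finite q hq).1
      (hH.finite _ (by linarith)).2
    linarith
  have hsanti : ∀ a b, 0 < a → a ≤ b → s b ≤ s a := by
    intro a b ha hab
    rcases hab.eq_or_lt with rfl | hab
    · rfl
    have h1 := hs' a b ha (ha.trans hab)
    have h2 := hs' b a (ha.trans hab) ha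
    nlinarith
  have key : ∀ l ≤ m, ∀ σ : ℝ, 0 ≤ σ → (∀ i < l, 0 < q i → σ ≤ s (q i)) →
      ∑ i ∈ Finset.range l, (r i : EReal) * H (p i) +
        ((σ * ∑ i ∈ Finset.range l, r i * (q i - p i) : ℝ) : EReal) ≤
      ∑ i ∈ Finset.range l, (r i : EReal) * H (q i) := by
    intro l
    induction l with
    | zero => simp
    | succ l ih =>
      intro hl σ hσ hσs
      rcases (hq l hl).eq_or_lt with h0 | hpos
      · have hq0 : ∀ i ∈ Finset.range (l + 1), q i = 0 := fun i hi => by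
          have hi := Finset.mem_range.1 hi
          exact le_antisymm (h0 ▸ hmono i l (by omega) hl) (hq i (by omega))
        have hterm : ∀ i ∈ Finset.range (l + 1), r i * (q i - p i) ≤ 0 := fun i hi => by
          have hi' := Finset.mem_range.1 hi
          rw [hq0 i hi]
          have := mul_nonneg (hr i (by omega)).le (hp i (by omega))
          linarith
        have hsum := le_antisymm (Finset.sum_nonpos hterm) (hW _ hl)
        have hpq : ∀ i ∈ Finset.range (l + 1), p i = q i := fun i hi => by
          have := (Finset.sum_eq_zero_iff_of_nonpos hterm).1 hsum i hi
          have hri := hr i (by have := Finset.mem_range.1 hi; omega)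
          rcases mul_eq_zero.1 this with h | h <;> linarith
        rw [hsum, Finset.sum_congr rfl fun i hi => by rw [hpq i hi]]
        simp
      · have h1 := ih (by omega) (s (q l)) (hs0 _ hpos) fun i hi hqi =>
          hsanti _ _ hqi (hmono i l hi.le hl)
        have h2 : (r l : EReal) * H (p l) + ((s (q l) * (r l * (q l - p l)) : ℝ) : EReal) ≤
            (r l : EReal) * H (q l) := by
          have hrl : (0 : EReal) ≤ (r l : EReal) := by exact_mod_cast (hr l hl).le
          calc _ ≤ (r l : EReal) * (((H (q l)).toReal + s (q l) * (p l - q l) : ℝ) : EReal) +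
                ((s (q l) * (r l * (q l - p l)) : ℝ) : EReal) := by
                gcongr
                exact hs _ hpos _ (hp l hl)
            _ = (r l : EReal) * ((H (q l)).toReal : EReal) := by
                norm_cast
                ring
            _ = _ := by rw [EReal.coe_toReal (hH.finite _ hpos).2 (hH.finite _ hpos).1]
        have h3 : σ * ∑ i ∈ Finset.range (l + 1), r i * (q i - p i) ≤
            s (q l) * ∑ i ∈ Finset.range l, r i * (q i - p i) +
              s (q l) * (r l * (q l - p l)) := by
          rw [← mul_add, ← Finset.sum_range_succ]
          exact mul_le_mul_of_nonneg_right (hσs l (by omega) hpos) (hW _ hl)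
        rw [Finset.sum_range_succ _ l, Finset.sum_range_succ (fun i => (r i : EReal) * H (q i)) l]
        refine le_trans ?_ (add_le_add h1 h2)
        rw [add_add_add_comm, ← EReal.coe_add]
        gcongr
  simpa using key m le_rfl 0 le_rfl fun i _ h => hs0 _ h

/-- The comparison principle for sums of translates: for two node systems `x` and `y` there is a
cell index `k` such that the cell of `x` is contained in that of `y`, and the sum of translates
with nodes `y` dominates the one with nodes `x` there. -/
theorem MonotoneKernel.exists_index_dominating {K : ℝ → EReal} (hK : MonotoneKernel K) (n : ℕ)
    {r x y : ℕ → ℝ} (hr : ∀ i < n, 0 < r i) (hy : ∀ i j, i ≤ j → j < n → y i ≤ y j) :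
    ∃ k ≤ n, ∀ t, (∀ i < k, x i ≤ t) → (∀ i < n, k ≤ i → t ≤ x i) →
      ((∀ i < k, y i ≤ t) ∧ (∀ i < n, k ≤ i → t ≤ y i)) ∧
      ∑ i ∈ Finset.range n, (r i : EReal) * K (t - x i) ≤
        ∑ i ∈ Finset.range n, (r i : EReal) * K (t - y i) := by
  set W : ℕ → ℝ := fun m => ∑ i ∈ Finset.range m, r i * (y i - x i) with hWdef
  have hWsucc : ∀ m, W (m + 1) = W m + r m * (y m - x m) := fun m => Finset.sum_range_succ _ _
  obtain ⟨k, hk, hmin⟩ := Finset.exists_min_image (Finset.range (n + 1)) W ⟨0, by simp⟩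
  have hkn : k ≤ n := by simpa [Nat.lt_succ_iff] using hk
  replace hmin : ∀ m ≤ n, W k ≤ W m := fun m hm => hmin m (by simpa [Nat.lt_succ_iff] using hm)
  refine ⟨k, hkn, fun t hleft hright => ?_⟩
  have hyl : ∀ i < k, y i ≤ t := by
    intro i hi
    obtain ⟨j, rfl⟩ : ∃ j, k = j + 1 := ⟨k - 1, by omega⟩
    have h1 := hmin j (by omega)
    rw [hWsucc] at h1
    have h2 : y j ≤ x j := by
      by_contra! h
      have := mul_pos (hr j (by omega)) (sub_pos.2 h)
      linarith
    exact (hy i j (by omega) (by omega)).trans (h2.trans (hleft j (by omega)))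
  have hyr : ∀ i < n, k ≤ i → t ≤ y i := by
    intro i hi hki
    have h1 := hmin (k + 1) (by omega)
    rw [hWsucc] at h1
    have h2 : x k ≤ y k := by
      by_contra! h
      have := mul_neg_of_pos_of_neg (hr k (by omega)) (sub_neg.2 h)
      linarith
    exact ((hright k (by omega) le_rfl).trans h2).trans (hy k i hki hi)
  refine ⟨⟨hyl, hyr⟩, ?_⟩
  have hR : ∀ l, ∑ i ∈ Finset.range l, r (k + i) * ((y (k + i) - t) - (x (k + i) - t)) =
      W (k + l) - W k := by
    intro l
    induction l with
    | zero => simp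
    | succ l ih => rw [Finset.sum_range_succ, ih, ← add_assoc, hWsucc]; ring
  have hL : ∀ l ≤ k, ∑ i ∈ Finset.range l,
      r (k - 1 - i) * ((t - y (k - 1 - i)) - (t - x (k - 1 - i))) = W (k - l) - W k := by
    intro l hl
    induction l with
    | zero => simp
    | succ l ih =>
      rw [Finset.sum_range_succ, ih (by omega), show k - l = (k - 1 - l) + 1 by omega, hWsucc,
        show k - (l + 1) = k - 1 - l by omega]
      ring
  rw [← Finset.sum_range_add_sum_Ico _ hkn, ← Finset.sum_range_add_sum_Ico _ hkn]
  refine add_le_add ?_ ?_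
  · rw [← Finset.sum_range_reflect, ← Finset.sum_range_reflect (fun i => (r i : EReal) * K (t - y i))]
    refine hK.isHalfKernel.sum_le_sum (r := fun i => r (k - 1 - i))
      (p := fun i => t - x (k - 1 - i)) (q := fun i => t - y (k - 1 - i))
      (fun i hi => hr _ (by omega)) (fun i hi => sub_nonneg.2 (hleft _ (by omega)))
      (fun i hi => sub_nonneg.2 (hyl _ (by omega)))
      (fun i j hij hj => sub_le_sub_left (hy _ _ (by omega) (by omega)) _) (fun l hl => ?_)
    rw [hL l hl]
    exact sub_nonneg.2 (hmin _ (by omega))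
  · rw [Finset.sum_Ico_eq_sum_range, Finset.sum_Ico_eq_sum_range]
    have := hK.comp_neg.isHalfKernel.sum_le_sum (m := n - k) (r := fun i => r (k + i))
      (p := fun i => x (k + i) - t) (q := fun i => y (k + i) - t)
      (fun i hi => hr _ (by omega))
      (fun i hi => sub_nonneg.2 (hright _ (by omega) (by omega)))
      (fun i hi => sub_nonneg.2 (hyr _ (by omega) (by omega)))
      (fun i j hij hj => sub_le_sub_right (hy _ _ (by omega) (by omega)) _)
      (fun l hl => by
        rw [hR l]
        exact sub_nonneg.2 (hmin _ (by omega)))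
    simpa only [neg_sub] using this

/-- No node system strictly majorizes another one. -/
theorem exists_mloc_le_mloc {K : ℝ → EReal} (J : ℝ → EReal) (hK : MonotoneKernel K) {n : ℕ}
    {r : Fin n → ℝ} (hr : ∀ j, 0 < r j) (x : Fin n → ℝ) {y : Fin n → ℝ} (hy : Monotone y) :
    ∃ j, mloc K J r x j ≤ mloc K J r y j := by
  let ext (z : Fin n → ℝ) (i : ℕ) : ℝ := if h : i < n then z ⟨i, h⟩ else 0
  have hext : ∀ z (i : Fin n), ext z i = z i := fun z i => by simp [ext]
  obtain ⟨k, hk, h⟩ := hK.exists_index_dominating n (r := ext r) (x := ext x) (y := ext y)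
    (fun i hi => by simpa [hext] using (hext r ⟨i, hi⟩).symm ▸ hr ⟨i, hi⟩)
    (fun i j hij hj => by
      have := hy (show (⟨i, hij.trans_lt hj⟩ : Fin n) ≤ ⟨j, hj⟩ from hij)
      rwa [← hext y, ← hext y] at this)
  refine ⟨⟨k, by omega⟩, sSup_le ?_⟩
  rintro _ ⟨t, ⟨ht₁, ht₂⟩, rfl⟩
  obtain ⟨⟨hy₁, hy₂⟩, hle⟩ := h t
    (fun i hi => (hext x ⟨i, by omega⟩).trans_le (ht₁ _ hi))
    (fun i hi hki => (ht₂ ⟨i, hi⟩ hki).trans_eq (hext x ⟨i, hi⟩).symm)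
  simp only [Finset.sum_range, hext] at hle
  refine le_trans (add_le_add le_rfl hle) (le_sSup ⟨t, ⟨fun i hi => ?_, fun i hi => ?_⟩, rfl⟩)
  · exact (hext y i).symm.trans_le (hy₁ i hi)
  · exact (hy₂ i i.2 hi).trans_eq (hext y i)

/-- if `e ∈ S^∞` is an equioscillation point on `ℝ`, then it is both a
minimax and a maximin point: `M(S^∞) = m̄(e) = m̲(e) = m(S^∞)`. -/
theorem equioscillation_is_extremal (K J : ℝ → EReal) (hK : MonotoneKernel K)
    (n : ℕ) (hn : 0 < n) (r : Fin n → ℝ) (hr : ∀ j, 0 < r j)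
    (hJ : IsFieldFn n J) (hadm : IsAdmissible K J (∑ j, r j))
    (e : Fin n → ℝ) (he : Monotone e)
    (hequi : ∀ j j' : Fin (n + 1), mloc K J r e j = mloc K J r e j') :
    sInf ((fun y : Fin n → ℝ => ⨆ j : Fin (n + 1), mloc K J r y j) ''
        {y | Monotone y}) = (⨆ j : Fin (n + 1), mloc K J r e j) ∧
    (⨆ j : Fin (n + 1), mloc K J r e j) = (⨅ j : Fin (n + 1), mloc K J r e j) ∧
    (⨅ j : Fin (n + 1), mloc K J r e j) =
      sSup ((fun y : Fin n → ℝ => ⨅ j : Fin (n + 1), mloc K J r y j) ''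
        {y | Monotone y}) := by
  have hsup : ∀ j, ⨆ i, mloc K J r e i = mloc K J r e j := fun j => by
    simp_rw [hequi _ j, ciSup_const]
  have hinf : ∀ j, ⨅ i, mloc K J r e i = mloc K J r e j := fun j => by
    simp_rw [hequi _ j, ciInf_const]
  refine ⟨le_antisymm (sInf_le ⟨e, he, rfl⟩) (le_sInf ?_), (hsup 0).trans (hinf 0).symm,
    le_antisymm (le_sSup ⟨e, he, rfl⟩) (sSup_le ?_)⟩
  · rintro _ ⟨y, hy, rfl⟩
    obtain ⟨j, hj⟩ := exists_mloc_le_mloc J hK hr e hy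
    exact (hsup j).trans_le (hj.trans (le_iSup (mloc K J r y) j))
  · rintro _ ⟨y, hy, rfl⟩
    obtain ⟨j, hj⟩ := exists_mloc_le_mloc J hK hr y he
    exact ((iInf_le (mloc K J r y) j).trans hj).trans_eq (hinf j).symm
end
end

section
/- Let K be a monotone kernel function that is in addition singular and strictly concave on (−∞,0) and on (0,∞), let n ∈ ℕ, r₁,…,rₙ > 0 with R := r₁ + … + rₙ, and let J be an n-field function on ℝ that is R-admissible for K. Then the equioscillation point on ℝ is unique: if e, e' ∈ S^∞ both satisfy m₀(·) = m₁(·) = … = mₙ(·), then e = e'. -/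
open Filter Set Topology

noncomputable section

lemma ConcaveOn.add_le_add_of_add_eq {s : Set ℝ} {f : ℝ → ℝ} (hf : ConcaveOn ℝ s f)
    {a b c d : ℝ} (ha : a ∈ s) (hd : d ∈ s) (hab : a ≤ b) (hac : a ≤ c)
    (hsum : a + d = b + c) : f a + f d ≤ f b + f c := by
  rcases (show a ≤ d by linarith).eq_or_lt with had | had
  · have hb : b = a := by linarith
    have hc : c = a := by linarith
    rw [hb, hc, ← had]
  · have hpos : 0 < d - a := by linarith
    have h1 := hf.2 ha hd
      (div_nonneg (show 0 ≤ d - b by linarith) hpos.le)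
      (div_nonneg (show 0 ≤ b - a by linarith) hpos.le)
      (by field_simp; ring)
    have h2 := hf.2 ha hd
      (div_nonneg (show 0 ≤ d - c by linarith) hpos.le)
      (div_nonneg (show 0 ≤ c - a by linarith) hpos.le)
      (by field_simp; ring)
    simp only [smul_eq_mul] at h1 h2
    have e1 : (d - b) / (d - a) * a + (b - a) / (d - a) * d = b := by
      field_simp; ring
    have e2 : (d - c) / (d - a) * a + (c - a) / (d - a) * d = c := by
      field_simp; ring
    rw [e1] at h1
    rw [e2] at h2
    have hc : c = a + d - b := by linarith
    have e3 : (d - c) / (d - a) = 1 - (d - b) / (d - a) := by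
      rw [hc]; field_simp; ring
    have e4 : (c - a) / (d - a) = 1 - (b - a) / (d - a) := by
      rw [hc]; field_simp; ring
    have e5 : (d - b) / (d - a) = 1 - (b - a) / (d - a) := by
      field_simp; ring
    rw [e3, e4] at h2
    rw [e5] at h1 h2
    linarith

lemma StrictConcaveOn.strictMonoOn_of_monotoneOn {s : Set ℝ} {f : ℝ → ℝ}
    (hf : StrictConcaveOn ℝ s f) (hmono : MonotoneOn f s) : StrictMonoOn f s := by
  intro a ha b hb hab
  have hhalf : (0 : ℝ) < 1 / 2 := by norm_num
  have hmid := hf.2 ha hb hab.ne hhalf hhalf (by norm_num)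
  have hmem := hf.1 ha hb hhalf.le hhalf.le (by norm_num)
  have hle := hmono hmem hb (by simp only [smul_eq_mul]; linarith)
  simp only [smul_eq_mul] at hmid hle
  linarith

/-- The finite part `∑ rⱼ K(t - yⱼ)` of the sum of translates, as a real number. -/
def kernelSum (K : ℝ → EReal) {n : ℕ} (r y : Fin n → ℝ) (t : ℝ) : ℝ :=
  ∑ j, r j * (K (t - y j)).toReal

/-- At a node of a singular kernel the sum of translates is `-∞`. -/
lemma sumTrans_eq_bot {K : ℝ → EReal} (hsing : K 0 = ⊥) {n : ℕ} {r y : Fin n → ℝ}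
    (hr : ∀ j, 0 < r j) (J : ℝ → EReal) {t : ℝ} (ht : ∃ j, t = y j) :
    SumTrans K J r y t = ⊥ := by
  obtain ⟨j, rfl⟩ := ht
  rw [SumTrans, ← Finset.add_sum_erase _ _ (Finset.mem_univ j), sub_self, hsing,
    EReal.coe_mul_bot_of_pos (hr j), EReal.bot_add, EReal.add_bot]

namespace IsKernel

variable {K : ℝ → EReal}

lemma coe_toReal (hK : IsKernel K) {t : ℝ} (ht : t ≠ 0) : ((K t).toReal : EReal) = K t :=
  EReal.coe_toReal (hK.1 t ht).2 (hK.1 t ht).1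

/-- Shifting the kernel to the right changes it by an increment that is nondecreasing
on either side of the two singularities. -/
lemma shift_increment_mono (hK : IsKernel K) {a b t u : ℝ} (hab : a ≤ b) (htu : t ≤ u)
    (hside : b < t ∨ u < a) :
    (K (t - b)).toReal - (K (t - a)).toReal ≤ (K (u - b)).toReal - (K (u - a)).toReal := by
  rcases hside with h | h
  · have := hK.2.2.1.add_le_add_of_add_eq (a := t - b) (b := t - a) (c := u - b) (d := u - a)
      (by simp only [mem_Ioi]; linarith) (by simp only [mem_Ioi]; linarith)
      (by linarith) (by linarith) (by ring)
    linarith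
  · have := hK.2.1.add_le_add_of_add_eq (a := t - b) (b := t - a) (c := u - b) (d := u - a)
      (by simp only [mem_Iio]; linarith) (by simp only [mem_Iio]; linarith)
      (by linarith) (by linarith) (by ring)
    linarith

variable {n : ℕ} {r y z : Fin n → ℝ}

lemma sumTrans_eq (hK : IsKernel K) (J : ℝ → EReal) {t : ℝ} (ht : ∀ j, t ≠ y j) :
    SumTrans K J r y t = J t + (kernelSum K r y t : EReal) := by
  have hcoe : ∀ f : Fin n → ℝ, ((∑ j, f j : ℝ) : EReal) = ∑ j, (f j : EReal) := fun f =>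
    map_sum (⟨⟨(fun x : ℝ => (x : EReal)), EReal.coe_zero⟩, EReal.coe_add⟩ : ℝ →+ EReal) f _
  rw [SumTrans, kernelSum, hcoe]
  congr 1
  refine Finset.sum_congr rfl fun j _ => ?_
  rw [EReal.coe_mul, hK.coe_toReal (sub_ne_zero.2 (ht j))]

lemma kernelSum_increment_mono (hK : IsKernel K) (hr : ∀ j, 0 < r j) {t u : ℝ} (hyz : y ≤ z)
    (htu : t ≤ u) (hside : ∀ j, y j = z j ∨ z j < t ∨ u < y j) :
    kernelSum K r z t - kernelSum K r y t ≤ kernelSum K r z u - kernelSum K r y u := by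
  simp only [kernelSum, ← Finset.sum_sub_distrib, ← mul_sub]
  refine Finset.sum_le_sum fun j _ => mul_le_mul_of_nonneg_left ?_ (hr j).le
  rcases hside j with h | h
  · rw [h, sub_self, sub_self]
  · exact hK.shift_increment_mono (hyz j) htu h

lemma mloc_le (hK : IsKernel K) (hsing : K 0 = ⊥) (hr : ∀ j, 0 < r j) (J : ℝ → EReal)
    {i : Fin (n + 1)} {M : EReal}
    (h : ∀ t ∈ cell y i, (∀ j, t ≠ y j) → J t + (kernelSum K r y t : EReal) ≤ M) :
    mloc K J r y i ≤ M := by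
  refine sSup_le ?_
  rintro _ ⟨t, ht, rfl⟩
  by_cases hnode : ∃ j, t = y j
  · rw [sumTrans_eq_bot hsing hr J hnode]
    exact bot_le
  · rw [not_exists] at hnode
    rw [hK.sumTrans_eq J hnode]
    exact h t ht hnode

lemma le_mloc (hK : IsKernel K) (J : ℝ → EReal) {i : Fin (n + 1)} {t : ℝ} (ht : t ∈ cell y i)
    (hnode : ∀ j, t ≠ y j) : J t + (kernelSum K r y t : EReal) ≤ mloc K J r y i := by
  rw [← hK.sumTrans_eq J hnode]
  exact le_sSup ⟨t, ht, rfl⟩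

/-- A pointwise comparison of kernel sums on cells, away from the nodes, passes to the
local maxima. -/
lemma mloc_le_mloc_add (hK : IsKernel K) (hsing : K 0 = ⊥) (hr : ∀ j, 0 < r j) (J : ℝ → EReal)
    {i i' : Fin (n + 1)} {g : ℝ}
    (h : ∀ t ∈ cell y i, (∀ j, t ≠ y j) →
      t ∈ cell z i' ∧ (∀ j, t ≠ z j) ∧ kernelSum K r y t ≤ kernelSum K r z t + g) :
    mloc K J r y i ≤ mloc K J r z i' + (g : EReal) := by
  refine hK.mloc_le hsing hr J fun t ht hnode => ?_
  obtain ⟨ht', hnode', hle⟩ := h t ht hnode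
  calc J t + (kernelSum K r y t : EReal)
      ≤ J t + ((kernelSum K r z t + g : ℝ) : EReal) :=
        add_le_add le_rfl (by exact_mod_cast hle)
    _ = J t + (kernelSum K r z t : EReal) + (g : EReal) := by rw [EReal.coe_add, add_assoc]
    _ ≤ mloc K J r z i' + (g : EReal) :=
        add_le_add (hK.le_mloc J ht' hnode') le_rfl

/-- If the nodes move to the right while the `i`-th one stays fixed, then the local maximum to
the right of it grows at least as much as the one to the left of it. -/
lemma mloc_castSucc_le_mloc_succ (hK : IsKernel K) (hsing : K 0 = ⊥) (hr : ∀ j, 0 < r j)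
    (J : ℝ → EReal) (hy : StrictMono y) (hz : StrictMono z) (hyz : y ≤ z) {i : Fin n}
    (hi : y i = z i) (hequi : mloc K J r y i.castSucc = mloc K J r y i.succ) :
    mloc K J r z i.castSucc ≤ mloc K J r z i.succ := by
  set g : ℝ := kernelSum K r z (y i) - kernelSum K r y (y i) with hg
  have hleft : mloc K J r z i.castSucc ≤ mloc K J r y i.castSucc + (g : EReal) := by
    refine hK.mloc_le_mloc_add hsing hr J fun t ht hnode => ?_
    have hlt : ∀ j, j < i → z j < t := fun j hj =>
      lt_of_le_of_ne (ht.1 j (by simpa using hj)) (hnode j).symm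
    have hgt : t < y i := hi ▸ lt_of_le_of_ne (ht.2 i (by simp)) (hnode i)
    have hgt' : ∀ j, i ≤ j → t < y j := fun j hj => hgt.trans_le (hy.monotone hj)
    refine ⟨⟨fun j hj => (hyz j).trans (hlt j (by simpa using hj)).le,
      fun j hj => (hgt' j (by simpa using hj)).le⟩, fun j => ?_, ?_⟩
    · rcases lt_or_ge j i with hj | hj
      · exact ((hyz j).trans_lt (hlt j hj)).ne'
      · exact (hgt' j hj).ne
    · have := hK.kernelSum_increment_mono hr hyz hgt.le fun j => by
        rcases lt_trichotomy j i with hj | rfl | hj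
        · exact Or.inr (Or.inl (hlt j hj))
        · exact Or.inl hi
        · exact Or.inr (Or.inr (hy hj))
      linarith
  have hright : mloc K J r y i.succ ≤ mloc K J r z i.succ + ((-g : ℝ) : EReal) := by
    refine hK.mloc_le_mloc_add hsing hr J fun t ht hnode => ?_
    have hgt : ∀ j, i < j → t < y j := fun j hj =>
      lt_of_le_of_ne (ht.2 j (by simpa [Nat.succ_le_iff] using hj)) (hnode j)
    have hlt : y i < t := lt_of_le_of_ne (ht.1 i (by simp)) (hnode i).symm
    have hlt' : ∀ j, j ≤ i → z j < t := fun j hj => (hi ▸ hz.monotone hj).trans_lt hlt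
    refine ⟨⟨fun j hj => (hlt' j (by simpa [Nat.lt_succ_iff] using hj)).le,
      fun j hj => (hgt j (by simpa [Nat.succ_le_iff] using hj)).le.trans (hyz j)⟩,
      fun j => ?_, ?_⟩
    · rcases le_or_gt j i with hj | hj
      · exact (hlt' j hj).ne'
      · exact ((hgt j hj).trans_le (hyz j)).ne
    · have := hK.kernelSum_increment_mono hr hyz hlt.le fun j => by
        rcases lt_trichotomy j i with hj | rfl | hj
        · exact Or.inr (Or.inl (hi ▸ hz hj))
        · exact Or.inl hi
        · exact Or.inr (Or.inr (hgt j hj))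
      linarith
  calc mloc K J r z i.castSucc ≤ mloc K J r y i.succ + (g : EReal) := hequi ▸ hleft
    _ ≤ mloc K J r z i.succ + ((-g : ℝ) : EReal) + (g : EReal) := by gcongr
    _ = mloc K J r z i.succ := by
      rw [add_assoc, ← EReal.coe_add, neg_add_cancel, EReal.coe_zero, add_zero]

end IsKernel

namespace MonotoneKernel

variable {K : ℝ → EReal} {n : ℕ} {r y z : Fin n → ℝ}

lemma toReal_antitoneOn (hK : MonotoneKernel K) :
    AntitoneOn (fun t => (K t).toReal) (Iio (0 : ℝ)) := fun a ha b hb hab =>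
  EReal.toReal_le_toReal (hK.2.1 ha hb hab) (hK.1.1 b (ne_of_lt hb)).1 (hK.1.1 a (ne_of_lt ha)).2

lemma toReal_monotoneOn (hK : MonotoneKernel K) :
    MonotoneOn (fun t => (K t).toReal) (Ioi (0 : ℝ)) := fun a ha b hb hab =>
  EReal.toReal_le_toReal (hK.2.2 ha hb hab) (hK.1.1 a (ne_of_gt ha)).1 (hK.1.1 b (ne_of_gt hb)).2

/-- To the right of all nodes the kernel sum is nondecreasing. -/
lemma kernelSum_le_kernelSum (hK : MonotoneKernel K) (hr : ∀ j, 0 < r j) {t u : ℝ}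
    (ht : ∀ j, y j < t) (htu : t ≤ u) : kernelSum K r y t ≤ kernelSum K r y u := by
  refine Finset.sum_le_sum fun j _ => mul_le_mul_of_nonneg_left ?_ (hr j).le
  exact hK.toReal_monotoneOn (sub_pos.2 (ht j)) (sub_pos.2 ((ht j).trans_le htu)) (by linarith)

lemma kernelSum_le_of_le_of_gt (hK : MonotoneKernel K) (hr : ∀ j, 0 < r j) (hyz : y ≤ z) {t : ℝ}
    (ht : ∀ j, t < y j) : kernelSum K r y t ≤ kernelSum K r z t := by
  refine Finset.sum_le_sum fun j _ => mul_le_mul_of_nonneg_left ?_ (hr j).le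
  exact hK.toReal_antitoneOn (sub_neg.2 ((ht j).trans_le (hyz j))) (sub_neg.2 (ht j))
    (by linarith [hyz j])

lemma kernelSum_lt_of_lt (hK : MonotoneKernel K)
    (hstrict : StrictConcaveOn ℝ (Ioi (0 : ℝ)) (fun t => (K t).toReal)) (hr : ∀ j, 0 < r j)
    (hyz : y < z) {t : ℝ} (ht : ∀ j, z j < t) : kernelSum K r z t < kernelSum K r y t := by
  obtain ⟨hle, i, hi⟩ := Pi.lt_def.1 hyz
  refine Finset.sum_lt_sum (fun j _ => mul_le_mul_of_nonneg_left ?_ (hr j).le)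
    ⟨i, Finset.mem_univ i, mul_lt_mul_of_pos_left ?_ (hr i)⟩
  · exact hK.toReal_monotoneOn (sub_pos.2 (ht j)) (sub_pos.2 ((hle j).trans_lt (ht j)))
      (by linarith [hle j])
  · exact hstrict.strictMonoOn_of_monotoneOn hK.toReal_monotoneOn (sub_pos.2 (ht i))
      (sub_pos.2 (hi.trans (ht i))) (by linarith)

/-- The sum of translates tends to `-∞` at `+∞` for an admissible field. -/
lemma eventually_add_kernelSum_le (hK : MonotoneKernel K) (hr : ∀ j, 0 < r j) {J : ℝ → EReal}
    (hadm : IsAdmissible K J (∑ j, r j)) (y : Fin n → ℝ) (M : ℝ) :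
    ∀ᶠ t in atTop, J t + (kernelSum K r y t : EReal) ≤ M := by
  set C : ℝ := ∑ j, r j * ((K (1 + |y j|)).toReal - (K 1).toReal) with hC
  have hlim := (hadm.mono_left atTop_le_cocompact).eventually
    (gt_mem_nhds (EReal.bot_lt_coe (M - C)))
  have hnodes : ∀ᶠ t in atTop, ∀ j, y j < t :=
    eventually_all.2 fun j => eventually_gt_atTop (y j)
  filter_upwards [hlim, hnodes, eventually_ge_atTop (1 : ℝ)] with t ht hyt h1
  have hsum : kernelSum K r y t ≤ (∑ j, r j) * (K t).toReal + C := by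
    rw [hC, Finset.sum_mul, ← Finset.sum_add_distrib]
    refine Finset.sum_le_sum fun j _ => ?_
    rw [← mul_add]
    refine mul_le_mul_of_nonneg_left ?_ (hr j).le
    have habs := neg_abs_le (y j)
    have hpos := abs_nonneg (y j)
    have hmono := hK.toReal_monotoneOn (a := t - y j) (b := t + |y j|) (sub_pos.2 (hyt j))
      (by simp only [mem_Ioi]; linarith) (by linarith)
    have hconc := hK.1.2.2.1.add_le_add_of_add_eq (a := 1) (b := t) (c := 1 + |y j|)
      (d := t + |y j|) (by simp) (by simp only [mem_Ioi]; linarith) h1 (by linarith) (by ring)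
    simp only at hmono
    linarith
  calc J t + (kernelSum K r y t : EReal)
      ≤ J t + (((∑ j, r j) * (K t).toReal + C : ℝ) : EReal) := by
        gcongr
    _ = J t + ((∑ j, r j : ℝ) : EReal) * K t + (C : EReal) := by
        rw [EReal.coe_add, EReal.coe_mul, hK.1.coe_toReal (by linarith : t ≠ 0), add_assoc]
    _ ≤ ((M - C : ℝ) : EReal) + (C : EReal) := by gcongr
    _ = M := by rw [← EReal.coe_add, sub_add_cancel]

lemma lt_of_mem_cell_last {t : ℝ} (ht : t ∈ cell y (Fin.last n)) (hnode : ∀ j, t ≠ y j)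
    (j : Fin n) : y j < t :=
  lt_of_le_of_ne (ht.1 j (by simp)) (hnode j).symm

lemma mloc_last_ne_top (hK : MonotoneKernel K) (hsing : K 0 = ⊥) (hr : ∀ j, 0 < r j)
    {J : ℝ → EReal} (hJ : ∃ c : ℝ, ∀ t, J t ≤ (c : EReal))
    (hadm : IsAdmissible K J (∑ j, r j)) : mloc K J r y (Fin.last n) ≠ ⊤ := by
  obtain ⟨c, hc⟩ := hJ
  obtain ⟨T, hT⟩ := eventually_atTop.1 (hK.eventually_add_kernelSum_le hr hadm y 0)
  refine ne_top_of_le_ne_top (EReal.coe_ne_top (max 0 (c + kernelSum K r y T)))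
    (hK.1.mloc_le hsing hr J fun t ht hnode => ?_)
  rw [EReal.coe_strictMono.monotone.map_max]
  rcases le_total T t with h | h
  · exact le_max_of_le_left (hT t h)
  · refine le_max_of_le_right ?_
    rw [EReal.coe_add]
    refine add_le_add (hc t) ?_
    exact_mod_cast hK.kernelSum_le_kernelSum hr (lt_of_mem_cell_last ht hnode) h

/-- Moving nodes to the right strictly decreases the last local maximum. -/
lemma mloc_last_lt (hK : MonotoneKernel K) (hsing : K 0 = ⊥)
    (hstrict : StrictConcaveOn ℝ (Ioi (0 : ℝ)) (fun t => (K t).toReal)) (hr : ∀ j, 0 < r j)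
    {J : ℝ → EReal} (hadm : IsAdmissible K J (∑ j, r j)) (hyz : y < z)
    (htop : mloc K J r y (Fin.last n) ≠ ⊤) (hbot : mloc K J r y (Fin.last n) ≠ ⊥) :
    mloc K J r z (Fin.last n) < mloc K J r y (Fin.last n) := by
  set c : ℝ := (mloc K J r y (Fin.last n)).toReal with hc
  have hcm : (c : EReal) = mloc K J r y (Fin.last n) := EReal.coe_toReal htop hbot
  have hev := eventually_forall_ge_atTop.2 (hK.eventually_add_kernelSum_le hr hadm z (c - 1))
  obtain ⟨T, hT, hzT⟩ := (hev.and (eventually_all.2 fun j => eventually_gt_atTop (z j))).exists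
  set d : ℝ := kernelSum K r z T - kernelSum K r y T with hd
  have hdneg : d < 0 := sub_neg.2 (hK.kernelSum_lt_of_lt hstrict hr hyz hzT)
  have hle : mloc K J r z (Fin.last n) ≤ ((max (c - 1) (c + d) : ℝ) : EReal) := by
    refine hK.1.mloc_le hsing hr J fun t ht hnode => ?_
    have hzt := lt_of_mem_cell_last ht hnode
    have hyt : ∀ j, y j < t := fun j => (hyz.le j).trans_lt (hzt j)
    rw [EReal.coe_strictMono.monotone.map_max]
    rcases le_total T t with h | h
    · exact le_max_of_le_left (hT t h)
    · refine le_max_of_le_right ?_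
      have hinc := hK.1.kernelSum_increment_mono hr hyz.le h fun j => Or.inr (Or.inl (hzt j))
      calc J t + (kernelSum K r z t : EReal)
          ≤ J t + ((kernelSum K r y t + d : ℝ) : EReal) := by
            gcongr; exact_mod_cast (by linarith)
        _ = J t + (kernelSum K r y t : EReal) + (d : EReal) := by rw [EReal.coe_add, add_assoc]
        _ ≤ (c : EReal) + (d : EReal) := by
            gcongr
            rw [hcm]
            refine hK.1.le_mloc J ⟨fun j _ => (hyt j).le, fun j hj => ?_⟩ fun j => (hyt j).ne'
            exact absurd j.isLt (not_lt.2 hj)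
        _ = ((c + d : ℝ) : EReal) := (EReal.coe_add c d).symm
  refine hle.trans_lt ?_
  rw [← hcm]
  exact_mod_cast max_lt (by linarith) (by linarith)

end MonotoneKernel

lemma exists_mem_cell {n : ℕ} {y : Fin n → ℝ} (hy : Monotone y) (t : ℝ) : ∃ j, t ∈ cell y j := by
  classical
  let P : ℕ → Prop := fun m => ∀ i : Fin n, (i : ℕ) < m → y i ≤ t
  have hspec : P (Nat.findGreatest P n) :=
    Nat.findGreatest_spec (Nat.zero_le n) fun i hi => absurd hi (Nat.not_lt_zero _)
  refine ⟨⟨Nat.findGreatest P n, Nat.lt_succ_of_le (Nat.findGreatest_le n)⟩, hspec, fun i hi => ?_⟩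
  by_contra! hlt
  have hP : P (i + 1) := fun k hk =>
    (hy (Fin.le_def.2 (Nat.lt_succ_iff.1 hk))).trans hlt.le
  exact absurd (Nat.le_findGreatest i.isLt hP) (by simpa using hi)

/-- Some local maximum is not `-∞`, as there are more finite points of the field than nodes. -/
lemma IsKernel.exists_mloc_ne_bot {K J : ℝ → EReal} (hK : IsKernel K) {n : ℕ} {r y : Fin n → ℝ}
    (hy : Monotone y) (hJ : ∃ S : Finset ℝ, n < S.card ∧ ∀ x ∈ S, J x ≠ ⊥) :
    ∃ j, mloc K J r y j ≠ ⊥ := by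
  classical
  obtain ⟨S, hS, hfin⟩ := hJ
  obtain ⟨x, hxS, hx⟩ := Finset.exists_mem_notMem_of_card_lt_card
    (s := Finset.univ.image y) (t := S)
    ((Finset.card_image_le.trans_eq (Finset.card_fin n)).trans_lt hS)
  have hnode : ∀ j, x ≠ y j := fun j h => hx (h ▸ Finset.mem_image_of_mem y (Finset.mem_univ j))
  obtain ⟨j, hj⟩ := exists_mem_cell hy x
  refine ⟨j, ne_bot_of_le_ne_bot ?_ (hK.le_mloc J hj hnode)⟩
  simpa [EReal.add_eq_bot_iff] using hfin x hxS

/-- Coinciding nodes of a singular kernel enclose a cell with local maximum `-∞`. -/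
lemma strictMono_of_mloc_ne_bot {K J : ℝ → EReal} (hsing : K 0 = ⊥) {n : ℕ} {r y : Fin n → ℝ}
    (hr : ∀ j, 0 < r j) (hy : Monotone y) (h : ∀ j, mloc K J r y j ≠ ⊥) : StrictMono y := by
  refine hy.strictMono_of_injective fun i j hij => ?_
  by_contra hne
  wlog hlt : i < j generalizing i j
  · exact this j i hij.symm (Ne.symm hne) (lt_of_le_of_ne (not_lt.1 hlt) (Ne.symm hne))
  refine h i.succ (sSup_eq_bot.2 ?_)
  rintro _ ⟨t, ht, rfl⟩
  refine sumTrans_eq_bot hsing hr J ⟨i, le_antisymm ?_ (ht.1 i (by simp))⟩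
  exact hij ▸ ht.2 j (by simpa [Nat.succ_le_iff] using hlt)

/-- An equioscillation point dominates any other one. -/
lemma MonotoneKernel.le_of_equioscillation {K J : ℝ → EReal} (hK : MonotoneKernel K)
    (hsing : K 0 = ⊥) (hstrict : StrictConcaveOn ℝ (Ioi (0 : ℝ)) (fun t => (K t).toReal))
    {n : ℕ} {r y z : Fin n → ℝ} (hr : ∀ j, 0 < r j) (hJ : IsFieldFn n J)
    (hadm : IsAdmissible K J (∑ j, r j)) (hy : Monotone y) (hz : Monotone z)
    (hequi : ∀ j j' : Fin (n + 1), mloc K J r y j = mloc K J r y j')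
    (hequi' : ∀ j j' : Fin (n + 1), mloc K J r z j = mloc K J r z j') : z ≤ y := by
  have hybot : ∀ j, mloc K J r y j ≠ ⊥ := by
    obtain ⟨i, hi⟩ := hK.1.exists_mloc_ne_bot (r := r) hy hJ.2
    exact fun j => hequi i j ▸ hi
  have hzbot : ∀ j, mloc K J r z j ≠ ⊥ := by
    obtain ⟨i, hi⟩ := hK.1.exists_mloc_ne_bot (r := r) hz hJ.2
    exact fun j => hequi' i j ▸ hi
  have hys := strictMono_of_mloc_ne_bot hsing hr hy hybot
  have hzs := strictMono_of_mloc_ne_bot hsing hr hz hzbot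
  have hsup : StrictMono (y ⊔ z) := fun i j hij => max_lt_max (hys hij) (hzs hij)
  by_contra hnot
  have hlt : y < y ⊔ z := left_lt_sup.2 hnot
  have hmono : Monotone (mloc K J r (y ⊔ z)) := by
    refine Fin.monotone_iff_le_succ.2 fun i => ?_
    rcases le_total (z i) (y i) with h | h
    · exact hK.1.mloc_castSucc_le_mloc_succ hsing hr J hys hsup le_sup_left
        (sup_eq_left.2 h).symm (hequi _ _)
    · exact hK.1.mloc_castSucc_le_mloc_succ hsing hr J hzs hsup le_sup_right
        (sup_eq_right.2 h).symm (hequi' _ _)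
  have hfirst : mloc K J r y 0 ≤ mloc K J r (y ⊔ z) 0 := by
    have := hK.1.mloc_le_mloc_add (y := y) (z := y ⊔ z) (i := 0) (i' := 0) (g := 0) hsing hr J
      fun t ht hnode => by
        have hlt' : ∀ j, t < y j := fun j => lt_of_le_of_ne (ht.2 j (by simp)) (hnode j)
        refine ⟨⟨fun j hj => absurd hj (by simp), fun j _ => ?_⟩, fun j => ?_, ?_⟩
        · exact (hlt' j).le.trans (hlt.le j)
        · exact ((hlt' j).trans_le (hlt.le j)).ne
        · rw [add_zero]
          exact hK.kernelSum_le_of_le_of_gt hr hlt.le hlt'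
    simpa using this
  have hlast := hK.mloc_last_lt hsing hstrict hr hadm hlt
    (hK.mloc_last_ne_top hsing hr hJ.1 hadm) (hybot _)
  rw [hequi (Fin.last n) 0] at hlast
  exact absurd (hfirst.trans (hmono (Fin.zero_le _))) (not_le.2 hlast)

/-- if `K` is in addition singular and strictly concave on `(-∞,0)`
and `(0,∞)`, then the equioscillation point on `ℝ` is unique. -/
theorem equioscillation_unique (K J : ℝ → EReal) (hK : MonotoneKernel K)
    (hsing : K 0 = ⊥)
    (hstrict₁ : StrictConcaveOn ℝ (Iio (0 : ℝ)) (fun t => (K t).toReal))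
    (hstrict₂ : StrictConcaveOn ℝ (Ioi (0 : ℝ)) (fun t => (K t).toReal))
    (n : ℕ) (hn : 0 < n) (r : Fin n → ℝ) (hr : ∀ j, 0 < r j)
    (hJ : IsFieldFn n J) (hadm : IsAdmissible K J (∑ j, r j))
    (e e' : Fin n → ℝ) (he : Monotone e) (he' : Monotone e')
    (hequi : ∀ j j' : Fin (n + 1), mloc K J r e j = mloc K J r e j')
    (hequi' : ∀ j j' : Fin (n + 1), mloc K J r e' j = mloc K J r e' j') :
    e = e' := by
  exact le_antisymm
    (hK.le_of_equioscillation hsing hstrict₂ hr hJ hadm he' he hequi' hequi)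
    (hK.le_of_equioscillation hsing hstrict₂ hr hJ hadm he he' hequi hequi')
end
end
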